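/- Let ℓ = 1 and let u be the pre-gelation large-cluster solution on [0,T] with bounded large initial conditions satisfying u₂(0) > 0. Then for every n ≥ 2 there exist real constants a_j^(n), for 2n ≤ j ≤ 3n−2, such that u_n(t) = ∑_{j=2n}^{3n−2} a_j^(n) · m₁(t)^j for all t ∈ [0,T], where m₁(t) = m₁(0) − t; moreover a_{2n}^(n) > 0 and (−1)^n a_{3n−2}^(n) > 0. -/

import Mathlib

open Finset Filter Topology

noncomputable section

/-- Total particle number for large clusters `m₁(t) = ∑_{i > ℓ} i u_i(t)`. -/
def m1large (ℓ : ℕ) (u : ℕ → ℝ → ℝ) (t : ℝ) : ℝ :=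
  ∑' i : ℕ, if ℓ + 1 ≤ i then (i : ℝ) * u i t else 0

/-- Right-hand side of the large-cluster equation for `u n` (`n > ℓ`):
`(1/m₁²) ∑_{i=ℓ+1}^{n−1} i(n+ℓ−i) u_i u_{n+ℓ−i} − 2 n u_n/m₁`
(the sum is empty when `n = ℓ+1`). -/
def largeRHS (ℓ : ℕ) (u : ℕ → ℝ → ℝ) (n : ℕ) (t : ℝ) : ℝ :=
  (1 / (m1large ℓ u t) ^ 2) *
      (∑ i ∈ Finset.Icc (ℓ + 1) (n - 1),
        (i : ℝ) * ((n + ℓ - i : ℕ) : ℝ) * u i t * u (n + ℓ - i) t)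
    - 2 * (n : ℝ) * u n t / m1large ℓ u t

/-- A large-cluster solution on `[0,T]`: a nonnegative family
`u_n ∈ C¹([0,T],[0,1])` (`n > ℓ`) solving the large-cluster system, whose
first-moment series converges uniformly on `[0,T]`. -/
structure IsLargeSolution (ℓ : ℕ) (T : ℝ) (u : ℕ → ℝ → ℝ) : Prop where
  mem : ∀ n, ℓ < n → ∀ t ∈ Set.Icc (0 : ℝ) T, u n t ∈ Set.Icc (0 : ℝ) 1
  contDiff : ∀ n, ℓ < n → ContDiffOn ℝ 1 (u n) (Set.Icc 0 T)
  ode : ∀ n, ℓ < n → ∀ t ∈ Set.Icc (0 : ℝ) T,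
    HasDerivWithinAt (u n) (largeRHS ℓ u n t) (Set.Icc 0 T) t
  m1_unif : TendstoUniformlyOn
    (fun N t => ∑ i ∈ Finset.range N, if ℓ + 1 ≤ i then (i : ℝ) * u i t else 0)
    (m1large ℓ u) atTop (Set.Icc 0 T)

/-- A pre-gelation large-cluster solution: in addition the second-moment series
`m₂(t) = ∑_{i > ℓ} i² u_i(t)` converges uniformly on `[0,T]`. -/
structure IsPreGelLargeSolution (ℓ : ℕ) (T : ℝ) (u : ℕ → ℝ → ℝ)
    extends IsLargeSolution ℓ T u : Prop where
  m2_unif : TendstoUniformlyOn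
    (fun N t => ∑ i ∈ Finset.range N, if ℓ + 1 ≤ i then (i : ℝ) ^ 2 * u i t else 0)
    (fun t => ∑' i : ℕ, if ℓ + 1 ≤ i then (i : ℝ) ^ 2 * u i t else 0)
    atTop (Set.Icc 0 T)

open Polynomial in
/-- An antiderivative of a polynomial of degree `< m`. -/
lemma exists_antiderivative_of_natDegree_lt (q : ℝ[X]) {m : ℕ} (hq : q.natDegree < m) :
    ∃ Q : ℝ[X], derivative Q = q ∧ Q.natDegree ≤ m ∧ (m : ℝ) * Q.coeff m = q.coeff (m - 1) := by
  refine ⟨∑ j ∈ range m, C (q.coeff j / ((j : ℝ) + 1)) * X ^ (j + 1), ?_, ?_, ?_⟩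
  · conv_rhs => rw [q.as_sum_range_C_mul_X_pow' hq]
    rw [derivative_sum]
    refine Finset.sum_congr rfl fun j _ => ?_
    have hj : (j : ℝ) + 1 ≠ 0 := by positivity
    rw [derivative_C_mul_X_pow, Nat.add_sub_cancel]
    push_cast
    rw [div_mul_cancel₀ _ hj]
  · refine natDegree_sum_le_of_forall_le _ _ fun j hj => ?_
    exact (natDegree_C_mul_X_pow_le _ _).trans (Finset.mem_range.1 hj)
  · obtain ⟨k, rfl⟩ : ∃ k, m = k + 1 := ⟨m - 1, by omega⟩
    have hk : (k : ℝ) + 1 ≠ 0 := by positivity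
    simp only [finsetSum_coeff, coeff_C_mul, coeff_X_pow, Nat.add_sub_cancel]
    rw [Finset.sum_eq_single k]
    · push_cast
      field_simp
      simp
    · intro b _ hb
      simp [hb.symm]
    · simp

/-- The coagulation double sum, indexed by the sizes of the two merging clusters. -/
lemma sum_coagulation_eq (v : ℕ → ℝ) (r : ℝ) (N : ℕ) :
    ∑ n ∈ Ico 2 N, ((n : ℝ) - r) *
        ∑ i ∈ Icc 2 (n - 1), (i : ℝ) * ((n + 1 - i : ℕ) : ℝ) * v i * v (n + 1 - i) =
      ∑ p ∈ (Ico 2 N ×ˢ Ico 2 N).filter (fun p => p.1 + p.2 ≤ N),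
        (p.1 : ℝ) * p.2 * (p.1 + p.2 - 1 - r) * v p.1 * v p.2 := by
  simp_rw [Finset.mul_sum]
  rw [Finset.sum_sigma']
  refine Finset.sum_nbij' (fun a => (a.2, a.1 + 1 - a.2)) (fun p => ⟨p.1 + p.2 - 1, p.1⟩)
    ?_ ?_ ?_ ?_ ?_
  · rintro ⟨n, i⟩ h
    simp only [mem_sigma, mem_Ico, mem_Icc, mem_filter, mem_product] at h ⊢
    omega
  · rintro ⟨i, j⟩ h
    simp only [mem_sigma, mem_Ico, mem_Icc, mem_filter, mem_product] at h ⊢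
    omega
  · rintro ⟨n, i⟩ h
    simp only [mem_sigma, mem_Ico, mem_Icc] at h
    have : i + (n + 1 - i) - 1 = n := by omega
    simp only [this]
  · rintro ⟨i, j⟩ h
    simp only [mem_Ico, mem_filter, mem_product] at h
    simp only [Prod.mk.injEq, true_and]
    omega
  · rintro ⟨n, i⟩ h
    simp only [mem_sigma, mem_Ico, mem_Icc] at h
    have : ((n + 1 - i : ℕ) : ℝ) = n + 1 - i := by
      rw [Nat.cast_sub (by omega)]; push_cast; ring
    simp only [this]
    ring

lemma sum_square_eq (v : ℕ → ℝ) (r : ℝ) (s : Finset ℕ) :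
    ∑ p ∈ s ×ˢ s, (p.1 : ℝ) * p.2 * (p.1 + p.2 - 1 - r) * v p.1 * v p.2 =
      2 * (∑ n ∈ s, (n : ℝ) * (n - r) * v n) * (∑ n ∈ s, (n : ℝ) * v n)
        - (1 - r) * (∑ n ∈ s, (n : ℝ) * v n) ^ 2 := by
  have h1 : (∑ n ∈ s, (n : ℝ) * (n - r) * v n) * (∑ n ∈ s, (n : ℝ) * v n) =
      ∑ p ∈ s ×ˢ s, ((p.1 : ℝ) * (p.1 - r) * v p.1) * ((p.2 : ℝ) * v p.2) := by
    rw [Finset.sum_mul_sum, Finset.sum_product]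
  have h2 : (∑ n ∈ s, (n : ℝ) * v n) * (∑ n ∈ s, (n : ℝ) * (n - r) * v n) =
      ∑ p ∈ s ×ˢ s, ((p.1 : ℝ) * v p.1) * ((p.2 : ℝ) * (p.2 - r) * v p.2) := by
    rw [Finset.sum_mul_sum, Finset.sum_product]
  have h3 : (∑ n ∈ s, (n : ℝ) * v n) * (∑ n ∈ s, (n : ℝ) * v n) =
      ∑ p ∈ s ×ˢ s, ((p.1 : ℝ) * v p.1) * ((p.2 : ℝ) * v p.2) := by
    rw [Finset.sum_mul_sum, Finset.sum_product]
  have h4 : ∑ p ∈ s ×ˢ s, (p.1 : ℝ) * p.2 * (p.1 + p.2 - 1 - r) * v p.1 * v p.2 =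
      (∑ n ∈ s, (n : ℝ) * (n - r) * v n) * (∑ n ∈ s, (n : ℝ) * v n) +
      (∑ n ∈ s, (n : ℝ) * v n) * (∑ n ∈ s, (n : ℝ) * (n - r) * v n) -
      (1 - r) * ((∑ n ∈ s, (n : ℝ) * v n) * (∑ n ∈ s, (n : ℝ) * v n)) := by
    rw [h1, h2, h3, Finset.mul_sum, ← Finset.sum_add_distrib, ← Finset.sum_sub_distrib]
    exact Finset.sum_congr rfl fun p _ => by ring
  rw [h4]
  ring

lemma sum_coagulation_mem_Icc (v : ℕ → ℝ) (hv : ∀ n, 2 ≤ n → 0 ≤ v n) {r : ℝ} (hr : r ≤ 1)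
    {M N : ℕ} (hMN : 2 * M ≤ N) :
    ∑ n ∈ Ico 2 N, ((n : ℝ) - r) *
        ∑ i ∈ Icc 2 (n - 1), (i : ℝ) * ((n + 1 - i : ℕ) : ℝ) * v i * v (n + 1 - i) ∈ Set.Icc
      (2 * (∑ n ∈ Ico 2 M, (n : ℝ) * (n - r) * v n) * (∑ n ∈ Ico 2 M, (n : ℝ) * v n)
        - (1 - r) * (∑ n ∈ Ico 2 M, (n : ℝ) * v n) ^ 2)
      (2 * (∑ n ∈ Ico 2 N, (n : ℝ) * (n - r) * v n) * (∑ n ∈ Ico 2 N, (n : ℝ) * v n)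
        - (1 - r) * (∑ n ∈ Ico 2 N, (n : ℝ) * v n) ^ 2) := by
  have hnn : ∀ p ∈ Ico 2 N ×ˢ Ico 2 N,
      0 ≤ (p.1 : ℝ) * p.2 * (p.1 + p.2 - 1 - r) * v p.1 * v p.2 := by
    rintro ⟨i, j⟩ h
    simp only [mem_Ico, mem_product] at h
    have hi : (2 : ℝ) ≤ i := by exact_mod_cast h.1.1
    have hj : (2 : ℝ) ≤ j := by exact_mod_cast h.2.1
    have h1 := hv i h.1.1
    have h2 := hv j h.2.1
    have h3 : (0 : ℝ) ≤ i + j - 1 - r := by linarith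
    show 0 ≤ (i : ℝ) * j * (i + j - 1 - r) * v i * v j
    positivity
  rw [sum_coagulation_eq, ← sum_square_eq, ← sum_square_eq]
  constructor
  · refine Finset.sum_le_sum_of_subset_of_nonneg ?_ fun p hp _ => hnn p (Finset.mem_filter.1 hp).1
    rintro ⟨i, j⟩ h
    simp only [mem_filter, mem_Ico, mem_product] at h ⊢
    omega
  · exact Finset.sum_le_sum_of_subset_of_nonneg (Finset.filter_subset _ _) fun p hp _ => hnn p hp

lemma sum_range_ite_two_le (f : ℕ → ℝ) (N : ℕ) :
    ∑ i ∈ range N, (if 1 + 1 ≤ i then f i else 0) = ∑ i ∈ Ico 2 N, f i := by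
  rw [← Finset.sum_filter]
  refine Finset.sum_congr ?_ fun _ _ => rfl
  ext i
  simp only [mem_filter, mem_range, mem_Ico]
  omega

lemma monotone_sum_Ico_two {f : ℕ → ℝ} (hf : ∀ n, 2 ≤ n → 0 ≤ f n) :
    Monotone fun N => ∑ i ∈ Ico 2 N, f i := fun _ _ h =>
  Finset.sum_le_sum_of_subset_of_nonneg (Finset.Ico_subset_Ico_right h)
    fun i hi _ => hf i (Finset.mem_Ico.1 hi).1

lemma tendstoUniformlyOn_m1large {T : ℝ} {u : ℕ → ℝ → ℝ} (hu : IsLargeSolution 1 T u) :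
    TendstoUniformlyOn (fun (N : ℕ) t => ∑ i ∈ Ico 2 N, (i : ℝ) * u i t) (m1large 1 u) atTop
      (Set.Icc 0 T) := by
  have h1 := hu.m1_unif
  simpa only [sum_range_ite_two_le (fun i => (i : ℝ) * u i _)] using h1

lemma continuousOn_m1large {T : ℝ} {u : ℕ → ℝ → ℝ} (hu : IsLargeSolution 1 T u) :
    ContinuousOn (m1large 1 u) (Set.Icc 0 T) :=
  (tendstoUniformlyOn_m1large hu).continuousOn <| Frequently.of_forall
    fun _ => continuousOn_finsetSum _ fun i hi =>
      continuousOn_const.mul (hu.contDiff i (Finset.mem_Ico.1 hi).1).continuousOn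

lemma sum_Ico_le_m1large {T : ℝ} {u : ℕ → ℝ → ℝ} (hu : IsLargeSolution 1 T u) {t : ℝ}
    (ht : t ∈ Set.Icc 0 T) (N : ℕ) : ∑ i ∈ Ico 2 N, (i : ℝ) * u i t ≤ m1large 1 u t :=
  (monotone_sum_Ico_two fun n hn => mul_nonneg n.cast_nonneg (hu.mem n hn t ht).1).ge_of_tendsto
    ((tendstoUniformlyOn_m1large hu).tendsto_at ht) N

/-- Evolution of the truncated moment with weight `n - r`, up to an arbitrarily small error. -/
lemma eventually_abs_truncated_moment_le {T : ℝ} {u : ℕ → ℝ → ℝ}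
    (hu : IsPreGelLargeSolution 1 T u) {τ : ℝ} (hτ : τ ∈ Set.Icc 0 T)
    (hm : ∀ t ∈ Set.Icc 0 τ, 1 / 2 ≤ m1large 1 u t) {r : ℝ} (hr0 : 0 ≤ r) (hr1 : r ≤ 1)
    {ε : ℝ} (hε : 0 < ε) :
    ∀ᶠ N : ℕ in atTop, ∀ t ∈ Set.Icc 0 τ,
      |∑ n ∈ Ico 2 N, ((n : ℝ) - r) * u n t - ∑ n ∈ Ico 2 N, ((n : ℝ) - r) * u n 0
        + (1 - r) * t| ≤ ε * t := by
  have hunn : ∀ t ∈ Set.Icc 0 T, ∀ n, 2 ≤ n → 0 ≤ u n t := fun t ht n hn => (hu.mem n hn t ht).1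
  have h1 := tendstoUniformlyOn_m1large hu.toIsLargeSolution
  have h2 := hu.m2_unif
  simp only [sum_range_ite_two_le (fun i => (i : ℝ) ^ 2 * u i _)] at h2
  set m2 : ℝ → ℝ := fun t => ∑' i : ℕ, if 1 + 1 ≤ i then (i : ℝ) ^ 2 * u i t else 0
  have c1 := continuousOn_m1large hu.toIsLargeSolution
  have c2 : ContinuousOn m2 (Set.Icc 0 T) := h2.continuousOn <| Frequently.of_forall
    fun _ => continuousOn_finsetSum _ fun i hi =>
      continuousOn_const.mul (hu.contDiff i (Finset.mem_Ico.1 hi).1).continuousOn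
  obtain ⟨K1, hK1⟩ := isCompact_Icc.exists_bound_of_continuousOn c1
  obtain ⟨K2, hK2⟩ := isCompact_Icc.exists_bound_of_continuousOn c2
  set K := max (max K1 K2) 1
  have hKpos : 0 < K := lt_of_lt_of_le one_pos (le_max_right _ _)
  set δ := ε / (16 * K) with hδ
  have hδpos : 0 < δ := by positivity
  have hhalf : Tendsto (fun N : ℕ => N / 2) atTop atTop :=
    Nat.tendsto_div_const_atTop two_ne_zero
  filter_upwards [hhalf.eventually (Metric.tendstoUniformlyOn_iff.1 h1 δ hδpos),
    hhalf.eventually (Metric.tendstoUniformlyOn_iff.1 h2 δ hδpos)] with N e1 e2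
  have hder : ∀ s ∈ Set.Icc 0 τ, HasDerivWithinAt
      (fun s => ∑ n ∈ Ico 2 N, ((n : ℝ) - r) * u n s + (1 - r) * s)
      (∑ n ∈ Ico 2 N, ((n : ℝ) - r) * largeRHS 1 u n s + (1 - r) * 1) (Set.Icc 0 τ) s := by
    intro s hs
    have hsub : Set.Icc 0 τ ⊆ Set.Icc 0 T := Set.Icc_subset_Icc_right hτ.2
    refine HasDerivWithinAt.add ?_ ((hasDerivWithinAt_id s _).const_mul _)
    refine HasDerivWithinAt.fun_sum fun n hn => ?_
    exact ((hu.ode n (Finset.mem_Ico.1 hn).1 s (hsub hs)).mono hsub).const_mul _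
  have hbound : ∀ s ∈ Set.Icc 0 τ,
      ‖∑ n ∈ Ico 2 N, ((n : ℝ) - r) * largeRHS 1 u n s + (1 - r) * 1‖ ≤ ε := by
    intro s hs
    have hsT : s ∈ Set.Icc 0 T := Set.Icc_subset_Icc_right hτ.2 hs
    have hvn := hunn s hsT
    have hms := hm s hs
    have hMN : 2 * (N / 2) ≤ N := by omega
    have hMN' : N / 2 ≤ N := by omega
    obtain ⟨hS1, hS2⟩ := sum_coagulation_mem_Icc (fun n => u n s) hvn hr1 hMN
    have hAmono := monotone_sum_Ico_two (f := fun n => (n : ℝ) * u n s)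
      fun n hn => mul_nonneg n.cast_nonneg (hvn n hn)
    have hBmono := monotone_sum_Ico_two (f := fun n => (n : ℝ) ^ 2 * u n s)
      fun n hn => mul_nonneg (by positivity) (hvn n hn)
    have hw : ∀ n : ℕ, 2 ≤ n → 0 ≤ (n : ℝ) - r := fun n hn => by
      have : (2 : ℝ) ≤ n := by exact_mod_cast hn
      linarith
    have hCmono := monotone_sum_Ico_two (f := fun n => (n : ℝ) * (n - r) * u n s)
      fun n hn => mul_nonneg (mul_nonneg n.cast_nonneg (hw n hn)) (hvn n hn)
    have hA1 := sum_Ico_le_m1large hu.toIsLargeSolution hsT N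
    have hB1 := hBmono.ge_of_tendsto (h2.tendsto_at hsT) N
    have hA2 := hAmono hMN'
    have hC2 := hCmono hMN'
    have hA0 := hAmono (Nat.zero_le (N / 2))
    have hC0 := hCmono (Nat.zero_le (N / 2))
    have hCeq : ∀ k : ℕ, ∑ n ∈ Ico 2 k, (n : ℝ) * (n - r) * u n s =
        ∑ n ∈ Ico 2 k, (n : ℝ) ^ 2 * u n s - r * ∑ n ∈ Ico 2 k, (n : ℝ) * u n s := by
      intro k
      rw [Finset.mul_sum, ← Finset.sum_sub_distrib]
      exact Finset.sum_congr rfl fun n _ => by ring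
    have hCN := hCeq N
    have hCM := hCeq (N / 2)
    have d1 := (abs_lt.1 (e1 s hsT)).2
    have d2 := (abs_lt.1 (e2 s hsT)).2
    have hk1 : m1large 1 u s ≤ K := (le_abs_self _).trans
      ((hK1 s hsT).trans ((le_max_left _ _).trans (le_max_left _ _)))
    have hk2 : m2 s ≤ K := (le_abs_self _).trans
      ((hK2 s hsT).trans ((le_max_right _ _).trans (le_max_left _ _)))
    have hRHS : ∑ n ∈ Ico 2 N, ((n : ℝ) - r) * largeRHS 1 u n s =
        (∑ n ∈ Ico 2 N, ((n : ℝ) - r) * ∑ i ∈ Icc 2 (n - 1),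
          (i : ℝ) * ((n + 1 - i : ℕ) : ℝ) * u i s * u (n + 1 - i) s
          - 2 * m1large 1 u s * ∑ n ∈ Ico 2 N, (n : ℝ) * (n - r) * u n s) /
        (m1large 1 u s) ^ 2 := by
      have hne : m1large 1 u s ≠ 0 := by linarith
      rw [Finset.mul_sum, ← Finset.sum_sub_distrib, Finset.sum_div]
      refine Finset.sum_congr rfl fun n _ => ?_
      simp only [largeRHS, Nat.reduceAdd]
      field_simp
    rw [hRHS]
    simp only [Finset.Ico_eq_empty_of_le (Nat.zero_le 2), Finset.sum_empty] at hA0 hC0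
    simp only at hA1 hB1 hA2 hC2 hS1 hS2
    clear_value m2
    generalize (∑ n ∈ Ico 2 N, ((n : ℝ) - r) * ∑ i ∈ Icc 2 (n - 1),
          (i : ℝ) * ((n + 1 - i : ℕ) : ℝ) * u i s * u (n + 1 - i) s) = S at *
    generalize ∑ n ∈ Ico 2 N, (n : ℝ) * (n - r) * u n s = CN at *
    generalize ∑ n ∈ Ico 2 (N / 2), (n : ℝ) * (n - r) * u n s = CM at *
    generalize ∑ n ∈ Ico 2 N, (n : ℝ) * u n s = AN at *
    generalize ∑ n ∈ Ico 2 (N / 2), (n : ℝ) * u n s = AM at *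
    generalize ∑ n ∈ Ico 2 N, (n : ℝ) ^ 2 * u n s = BN at *
    generalize ∑ n ∈ Ico 2 (N / 2), (n : ℝ) ^ 2 * u n s = BM at *
    generalize m1large 1 u s = x at *
    generalize m2 s = y at *
    have hδK : 16 * (K * δ) = ε := by rw [hδ]; field_simp
    have hx2 : 1 / 4 ≤ x ^ 2 := by nlinarith
    have hCd : CN - CM ≤ δ := by nlinarith
    have hCMK : CM ≤ K := by nlinarith
    have key : |S - 2 * x * CN + (1 - r) * x ^ 2| ≤ 4 * (K * δ) := by
      have p1 : x * (CN - CM) ≤ K * δ :=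
        mul_le_mul hk1 hCd (by linarith) hKpos.le
      have p2 : CM * (x - AM) ≤ K * δ :=
        mul_le_mul hCMK d1.le (by linarith) hKpos.le
      have p3 : (x + AN) * (x - AN) ≤ (2 * K) * δ :=
        mul_le_mul (by linarith) (by linarith) (by linarith) (by linarith)
      have p4 : 0 ≤ (x + AN) * (x - AN) := mul_nonneg (by linarith) (by linarith)
      have p5 : 0 ≤ (x + AM) * (x - AM) := mul_nonneg (by linarith) (by linarith)
      have p6 : 0 ≤ CN * (x - AN) := mul_nonneg (by linarith) (by linarith)
      have p7 := mul_nonneg (sub_nonneg.2 hr1) p5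
      have p8 := mul_nonneg hr0 p4
      have p9 : 0 < K * δ := by positivity
      rw [abs_le]
      constructor <;> nlinarith
    have hx2' : 0 < x ^ 2 := by linarith
    have : (S - 2 * x * CN) / x ^ 2 + (1 - r) * 1 =
        (S - 2 * x * CN + (1 - r) * x ^ 2) / x ^ 2 := by
      field_simp
    rw [this, Real.norm_eq_abs, abs_div, abs_of_pos hx2', div_le_iff₀ hx2']
    nlinarith
  intro t ht
  have := (convex_Icc 0 τ).norm_image_sub_le_of_norm_hasDerivWithin_le hder hbound
    (Set.left_mem_Icc.2 hτ.1) ht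
  rw [Real.norm_eq_abs, Real.norm_eq_abs, sub_zero, abs_of_nonneg ht.1] at this
  refine le_trans (le_of_eq ?_) this
  congr 1
  ring

/-- The conserved quantity `∑ (n - 1) u_n` keeps `m₁` away from zero. -/
lemma half_le_m1large {T : ℝ} {u : ℕ → ℝ → ℝ} (hu : IsPreGelLargeSolution 1 T u)
    (hinit : HasSum (fun i : ℕ => if 2 ≤ i then u i 0 else 0) 1) {t : ℝ}
    (ht : t ∈ Set.Icc 0 T) : 1 / 2 ≤ m1large 1 u t := by
  have h0T : (0 : ℝ) ∈ Set.Icc 0 T := ⟨le_rfl, ht.1.trans ht.2⟩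
  have hZ : Tendsto (fun N : ℕ => ∑ i ∈ Ico 2 N, u i 0) atTop (𝓝 1) := by
    have := hinit.tendsto_sum_nat
    simpa only [sum_range_ite_two_le (fun i => u i 0)] using this
  have hm0 : 1 ≤ m1large 1 u 0 := by
    refine le_of_tendsto' hZ fun N => le_trans (Finset.sum_le_sum fun i hi => ?_)
      (sum_Ico_le_m1large hu.toIsLargeSolution h0T N)
    have hi2 := (Finset.mem_Ico.1 hi).1
    have : (2 : ℝ) ≤ i := by exact_mod_cast hi2
    nlinarith [(hu.mem i hi2 0 h0T).1]
  have hc := continuousOn_m1large hu.toIsLargeSolution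
  have hivt : ∀ s ∈ Set.Icc 0 T, m1large 1 u s < 1 / 2 →
      ∃ a ∈ Set.Icc 0 s, m1large 1 u a = 1 / 2 := fun s hs hlt => by
    obtain ⟨a, ha, hav⟩ := intermediate_value_Icc' hs.1
      (hc.mono (Set.Icc_subset_Icc_right hs.2)) (show (1 / 2 : ℝ) ∈ _ from ⟨hlt.le, by linarith⟩)
    exact ⟨a, ha, hav⟩
  by_contra! hlt
  obtain ⟨a, ha, hav⟩ := hivt t ht hlt
  have hcomp : IsCompact (Set.Icc 0 T ∩ m1large 1 u ⁻¹' {1 / 2}) :=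
    isCompact_Icc.of_isClosed_subset
      (hc.preimage_isClosed_of_isClosed isClosed_Icc isClosed_singleton) Set.inter_subset_left
  obtain ⟨τ, ⟨hτ, hτv⟩, hmin⟩ := hcomp.exists_isLeast ⟨a, ⟨ha.1, ha.2.trans ht.2⟩, hav⟩
  have hm : ∀ s ∈ Set.Icc 0 τ, 1 / 2 ≤ m1large 1 u s := by
    intro s hs
    by_contra! hslt
    obtain ⟨b, hb, hbv⟩ := hivt s ⟨hs.1, hs.2.trans hτ.2⟩ hslt
    have h1 : τ ≤ b := hmin ⟨⟨hb.1, hb.2.trans (hs.2.trans hτ.2)⟩, hbv⟩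
    have h2 : s = b := le_antisymm (hs.2.trans h1) hb.2
    rw [h2, hbv] at hslt
    exact lt_irrefl _ hslt
  have hτ1 : 0 < τ + 1 := by linarith [hτ.1]
  obtain ⟨N, hN, hN'⟩ := ((eventually_abs_truncated_moment_le hu hτ hm zero_le_one le_rfl
    (ε := 1 / (4 * (τ + 1))) (by positivity)).and
    (hZ.eventually (lt_mem_nhds (show (7 / 8 : ℝ) < 1 by norm_num)))).exists
  have h1 := (abs_le.1 (hN τ ⟨hτ.1, le_rfl⟩)).1
  have h2 : 1 / (4 * (τ + 1)) * τ ≤ 1 / 4 := by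
    rw [div_mul_eq_mul_div, div_le_div_iff₀ (by positivity) (by norm_num)]
    linarith
  have h3 : ∑ n ∈ Ico 2 N, u n 0 ≤ ∑ n ∈ Ico 2 N, ((n : ℝ) - 1) * u n 0 := by
    refine Finset.sum_le_sum fun i hi => ?_
    have hi2 := (Finset.mem_Ico.1 hi).1
    have : (2 : ℝ) ≤ i := by exact_mod_cast hi2
    nlinarith [(hu.mem i hi2 0 h0T).1]
  have h4 : ∑ n ∈ Ico 2 N, ((n : ℝ) - 1) * u n τ ≤ m1large 1 u τ := by
    refine le_trans (Finset.sum_le_sum fun i hi => ?_)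
      (sum_Ico_le_m1large hu.toIsLargeSolution hτ N)
    have hi2 := (Finset.mem_Ico.1 hi).1
    nlinarith [(hu.mem i hi2 τ hτ).1]
  rw [show m1large 1 u τ = 1 / 2 from hτv] at h4
  linarith

lemma m1large_eq_sub {T : ℝ} {u : ℕ → ℝ → ℝ} (hu : IsPreGelLargeSolution 1 T u)
    (hinit : HasSum (fun i : ℕ => if 2 ≤ i then u i 0 else 0) 1) {t : ℝ}
    (ht : t ∈ Set.Icc 0 T) : m1large 1 u t = m1large 1 u 0 - t := by
  have hT : 0 ≤ T := ht.1.trans ht.2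
  have hlim : Tendsto (fun N : ℕ => |∑ n ∈ Ico 2 N, (n : ℝ) * u n t - ∑ n ∈ Ico 2 N, (n : ℝ) * u n 0
      + t|) atTop (𝓝 |m1large 1 u t - m1large 1 u 0 + t|) := by
    have h := tendstoUniformlyOn_m1large hu.toIsLargeSolution
    exact (((h.tendsto_at ht).sub (h.tendsto_at ⟨le_rfl, hT⟩)).add_const t).abs
  have hle : |m1large 1 u t - m1large 1 u 0 + t| ≤ 0 := by
    refine le_of_forall_pos_le_add fun ε hε => ?_
    have hT1 : 0 < T + 1 := by linarith
    refine le_of_tendsto hlim ?_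
    filter_upwards [eventually_abs_truncated_moment_le hu ⟨hT, le_rfl⟩
      (fun s hs => half_le_m1large hu hinit hs) le_rfl zero_le_one
      (show 0 < ε / (T + 1) by positivity)] with N hN
    have := hN t ht
    simp only [sub_zero, one_mul] at this
    refine this.trans ?_
    rw [zero_add, div_mul_eq_mul_div, div_le_iff₀ hT1]
    nlinarith [ht.2]
  have := abs_nonpos_iff.1 hle
  linarith

open Polynomial in
/-- `p` is the polynomial factor of `u n`: with `x = m₁`, one has `u n = x ^ (2 * n) * p(x)`. -/
structure IsPolynomialFactor (T : ℝ) (u : ℕ → ℝ → ℝ) (n : ℕ) (p : ℝ[X]) : Prop where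
  natDegree_le : p.natDegree ≤ n - 2
  eq_eval : ∀ t ∈ Set.Icc 0 T, u n t = m1large 1 u t ^ (2 * n) * p.eval (m1large 1 u t)
  pos : ∀ y ∈ Set.Ico 0 (m1large 1 u 0), 0 < p.eval y
  coeff_sign : 0 < (-1 : ℝ) ^ n * p.coeff (n - 2)

open Polynomial in
/-- A polynomial satisfying the recursion `p_n' = -∑ i (n + 1 - i) p_i p_{n+1-i}` and agreeing
with `u n` at time `0` represents `u n` on the whole time interval. -/
lemma eq_eval_of_derivative_eq {T : ℝ} {u : ℕ → ℝ → ℝ} (hu : IsLargeSolution 1 T u)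
    (hpos : ∀ t ∈ Set.Icc 0 T, 0 < m1large 1 u t)
    (hm : ∀ t ∈ Set.Icc 0 T, m1large 1 u t = m1large 1 u 0 - t) {n : ℕ} (hn : 2 ≤ n)
    (P : ℕ → ℝ[X]) (hP : ∀ i ∈ Icc 2 (n - 1), ∀ t ∈ Set.Icc 0 T,
      u i t = m1large 1 u t ^ (2 * i) * (P i).eval (m1large 1 u t))
    (p : ℝ[X]) (hp : derivative p =
      -∑ i ∈ Icc 2 (n - 1), C ((i : ℝ) * ((n + 1 - i : ℕ) : ℝ)) * (P i * P (n + 1 - i)))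
    (hp0 : p.eval (m1large 1 u 0) = u n 0 / m1large 1 u 0 ^ (2 * n))
    {t : ℝ} (ht : t ∈ Set.Icc 0 T) :
    u n t = m1large 1 u t ^ (2 * n) * p.eval (m1large 1 u t) := by
  set x0 := m1large 1 u 0
  have h0T : (0 : ℝ) ∈ Set.Icc 0 T := ⟨le_rfl, ht.1.trans ht.2⟩
  have hder : ∀ s ∈ Set.Icc 0 T, HasDerivWithinAt
      (fun s => u n s / (x0 - s) ^ (2 * n) - p.eval (x0 - s)) 0 (Set.Icc 0 T) s := by
    intro s hs
    have hxs : 0 < x0 - s := hm s hs ▸ hpos s hs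
    have hx : HasDerivWithinAt (fun s : ℝ => x0 - s) (-1) (Set.Icc 0 T) s := by
      simpa using (hasDerivWithinAt_id s (Set.Icc 0 T)).const_sub x0
    have h1 := ((hu.ode n hn s hs).div (hx.fun_pow (2 * n)) (pow_pos hxs _).ne').sub
      ((p.hasDerivAt (x0 - s)).comp_hasDerivWithinAt s hx)
    refine h1.congr_deriv ?_
    have hS : ∑ i ∈ Icc 2 (n - 1), (i : ℝ) * ((n + 1 - i : ℕ) : ℝ) * u i s * u (n + 1 - i) s =
        -((x0 - s) ^ (2 * n + 2) * (derivative p).eval (x0 - s)) := by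
      rw [hp, eval_neg, eval_finsetSum, mul_neg, neg_neg, Finset.mul_sum]
      refine Finset.sum_congr rfl fun i hi => ?_
      have hi' := Finset.mem_Icc.1 hi
      rw [hP i hi s hs, hP (n + 1 - i) (Finset.mem_Icc.2 (by omega)) s hs, hm s hs,
        show 2 * n + 2 = 2 * i + 2 * (n + 1 - i) by omega, pow_add]
      simp only [eval_mul, eval_C]
      ring
    obtain ⟨k, hk⟩ : ∃ k, 2 * n = k + 1 := ⟨2 * n - 1, by omega⟩
    have hk' : 2 * (n : ℝ) = k + 1 := by exact_mod_cast hk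
    simp only [largeRHS, Nat.reduceAdd, hS, hm s hs, hk, hk', Nat.add_sub_cancel]
    push_cast
    field_simp
    ring
  have hconst := (convex_Icc 0 T).norm_image_sub_le_of_norm_hasDerivWithin_le hder
    (C := 0) (fun s _ => by simp) h0T ht
  rw [zero_mul, norm_le_zero_iff, sub_zero, hp0, sub_self, sub_zero, ← hm t ht] at hconst
  have := hpos t ht
  rw [sub_eq_zero, div_eq_iff (by positivity)] at hconst
  rw [hconst, mul_comm]

open Polynomial in
lemma exists_isPolynomialFactor {T : ℝ} (hT : 0 ≤ T) {u : ℕ → ℝ → ℝ} (hu : IsLargeSolution 1 T u)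
    (hpos : ∀ t ∈ Set.Icc 0 T, 0 < m1large 1 u t)
    (hm : ∀ t ∈ Set.Icc 0 T, m1large 1 u t = m1large 1 u 0 - t) (hdimer : 0 < u 2 0)
    {n : ℕ} (hn : 2 ≤ n) : ∃ p, IsPolynomialFactor T u n p := by
  have h0T : (0 : ℝ) ∈ Set.Icc 0 T := ⟨le_rfl, hT⟩
  have hx0 := hpos 0 h0T
  induction n using Nat.strong_induction_on with
  | _ n ih =>
  rcases hn.eq_or_lt with rfl | hn3
  · have hc : 0 < u 2 0 / m1large 1 u 0 ^ (2 * 2) := by positivity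
    refine ⟨C (u 2 0 / m1large 1 u 0 ^ (2 * 2)), by simp, fun t ht => ?_, fun y _ => ?_, ?_⟩
    · exact eq_eval_of_derivative_eq hu hpos hm le_rfl 0 (fun i hi => by simp at hi) _ (by simp)
        (by simp) ht
    · simpa using hc
    · simpa using hc
  · choose! P hP using ih
    have hP' : ∀ i ∈ Icc 2 (n - 1), IsPolynomialFactor T u i (P i) := fun i hi => by
      have := Finset.mem_Icc.1 hi
      exact hP i (by omega) this.1
    have hrefl : ∀ i ∈ Icc 2 (n - 1), n + 1 - i ∈ Icc 2 (n - 1) := fun i hi => by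
      have := Finset.mem_Icc.1 hi
      exact Finset.mem_Icc.2 (by omega)
    have hne : (Icc 2 (n - 1)).Nonempty := Finset.nonempty_Icc.2 (by omega)
    have hwt : ∀ i ∈ Icc 2 (n - 1), 0 < (i : ℝ) * ((n + 1 - i : ℕ) : ℝ) := fun i hi => by
      have h1 := Finset.mem_Icc.1 hi
      have h2 : 0 < i * (n + 1 - i) := Nat.mul_pos (by omega) (by omega)
      exact_mod_cast h2
    set q := ∑ i ∈ Icc 2 (n - 1), C ((i : ℝ) * ((n + 1 - i : ℕ) : ℝ)) * (P i * P (n + 1 - i))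
      with hq
    have hqdeg : q.natDegree < n - 2 := by
      have : q.natDegree ≤ n - 3 := by
        refine natDegree_sum_le_of_forall_le _ _ fun i hi => ?_
        have h1 := (hP' i hi).natDegree_le
        have h2 := (hP' _ (hrefl i hi)).natDegree_le
        have h3 := Finset.mem_Icc.1 hi
        refine (natDegree_C_mul_le _ _).trans (natDegree_mul_le.trans ?_)
        omega
      omega
    have hqpos : ∀ y ∈ Set.Ico 0 (m1large 1 u 0), 0 < q.eval y := fun y hy => by
      rw [hq, eval_finsetSum]
      refine Finset.sum_pos (fun i hi => ?_) hne
      rw [eval_mul, eval_mul, eval_C]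
      exact mul_pos (hwt i hi) (mul_pos ((hP' i hi).pos y hy) ((hP' _ (hrefl i hi)).pos y hy))
    have hqcoeff : 0 < (-1 : ℝ) ^ (n + 1) * q.coeff (n - 3) := by
      rw [hq, finsetSum_coeff, Finset.mul_sum]
      refine Finset.sum_pos (fun i hi => ?_) hne
      have h3 := Finset.mem_Icc.1 hi
      have h4 := mul_pos (hwt i hi)
        (mul_pos (hP' i hi).coeff_sign (hP' _ (hrefl i hi)).coeff_sign)
      rw [coeff_C_mul, show n - 3 = (i - 2) + (n + 1 - i - 2) by omega,
        coeff_mul_add_eq_of_natDegree_le (hP' i hi).natDegree_le (hP' _ (hrefl i hi)).natDegree_le]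
      have h5 : (-1 : ℝ) ^ (n + 1) = (-1) ^ i * (-1) ^ (n + 1 - i) := by
        rw [← pow_add]; congr 1; omega
      rw [h5]
      refine h4.trans_eq ?_
      ring
    obtain ⟨Q, hQ, hQdeg, hQcoeff⟩ := exists_antiderivative_of_natDegree_lt q hqdeg
    set c := u n 0 / m1large 1 u 0 ^ (2 * n) + Q.eval (m1large 1 u 0) with hc
    have hder : derivative (C c - Q) = -q := by simp [hQ]
    have heval : (C c - Q).eval (m1large 1 u 0) = u n 0 / m1large 1 u 0 ^ (2 * n) := by
      simp [hc]
    refine ⟨C c - Q, ?_, fun t ht => ?_, fun y hy => ?_, ?_⟩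
    · exact (natDegree_sub_le _ _).trans (by simpa using hQdeg)
    · exact eq_eval_of_derivative_eq hu hpos hm hn P (fun i hi => (hP' i hi).eq_eval) _ hder
        heval ht
    · have hanti : StrictAntiOn (fun y => (C c - Q).eval y) (Set.Icc 0 (m1large 1 u 0)) := by
        refine strictAntiOn_of_deriv_neg (convex_Icc _ _) (Polynomial.continuousOn _)
          fun z hz => ?_
        rw [interior_Icc] at hz
        rw [Polynomial.deriv, hder, eval_neg, neg_lt_zero]
        exact hqpos z ⟨hz.1.le, hz.2⟩
      have h1 := hanti ⟨hy.1, hy.2.le⟩ ⟨hx0.le, le_rfl⟩ hy.2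
      simp only [heval] at h1
      exact lt_of_le_of_lt (div_nonneg (hu.mem n hn 0 h0T).1 (by positivity)) h1
    · have hn2 : (0 : ℝ) < ((n - 2 : ℕ) : ℝ) := by
        have : 0 < n - 2 := by omega
        exact_mod_cast this
      rw [coeff_sub, coeff_C, if_neg (by omega), zero_sub]
      rw [show n - 3 = n - 2 - 1 by omega, ← hQcoeff, pow_succ] at hqcoeff
      refine pos_of_mul_pos_right (a := ((n - 2 : ℕ) : ℝ)) ?_ hn2.le
      refine hqcoeff.trans_eq ?_
      ring

/-- polynomial solution form for `ℓ = 1`: let `u` be the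
pre-gelation large-cluster solution on `[0,T]` with bounded large initial
conditions satisfying `u₂(0) > 0`.  Then `m₁(t) = m₁(0) − t`, and for every
`n ≥ 2` there are real constants `a_j^(n)` (`2n ≤ j ≤ 3n−2`) with
`u_n(t) = ∑_{j=2n}^{3n−2} a_j^(n) m₁(t)^j` on `[0,T]`, `a_{2n}^(n) > 0` and
`(−1)^n a_{3n−2}^(n) > 0`. -/
theorem polynomial_solution_form (L : ℕ) (hL : 2 ≤ L) (T : ℝ) (hT : 0 < T)
    (u : ℕ → ℝ → ℝ) (hu : IsPreGelLargeSolution 1 T u)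
    (hinit_small : ∀ i, i ≤ 1 → u i 0 = 0)
    (hinit_nonneg : ∀ i, 0 ≤ u i 0)
    (hinit_sum : HasSum (fun i : ℕ => if 2 ≤ i then u i 0 else 0) 1)
    (hinit_bdd : ∀ i, L < i → u i 0 = 0)
    (hdimer : 0 < u 2 0) :
    (∀ t ∈ Set.Icc (0 : ℝ) T, m1large 1 u t = m1large 1 u 0 - t) ∧
    ∀ n : ℕ, 2 ≤ n → ∃ a : ℕ → ℝ,
      (∀ t ∈ Set.Icc (0 : ℝ) T,
        u n t = ∑ j ∈ Finset.Icc (2 * n) (3 * n - 2), a j * (m1large 1 u t) ^ j) ∧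
      0 < a (2 * n) ∧ 0 < (-1 : ℝ) ^ n * a (3 * n - 2) := by

  have hpos : ∀ t ∈ Set.Icc 0 T, 0 < m1large 1 u t := fun t ht =>
    lt_of_lt_of_le (by norm_num) (half_le_m1large hu hinit_sum ht)
  have hm : ∀ t ∈ Set.Icc 0 T, m1large 1 u t = m1large 1 u 0 - t := fun t ht =>
    m1large_eq_sub hu hinit_sum ht
  refine ⟨hm, fun n hn => ?_⟩
  obtain ⟨p, hp⟩ := exists_isPolynomialFactor hT.le hu.toIsLargeSolution hpos hm hdimer hn
  refine ⟨fun j => p.coeff (j - 2 * n), fun t ht => ?_, ?_, ?_⟩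
  · rw [hp.eq_eval t ht, Polynomial.eval_eq_sum_range' (Nat.lt_succ_of_le hp.natDegree_le),
      Finset.mul_sum]
    refine Finset.sum_nbij' (fun k => k + 2 * n) (fun j => j - 2 * n) ?_ ?_ ?_ ?_ ?_
    · intro k hk
      simp only [mem_range, mem_Icc] at hk ⊢
      omega
    · intro j hj
      simp only [mem_range, mem_Icc] at hj ⊢
      omega
    · intro k _
      simp
    · intro j hj
      simp only [mem_Icc] at hj
      omega
    · intro k _
      simp only [Nat.add_sub_cancel, pow_add]
      ring
  · have := hp.pos 0 ⟨le_rfl, hpos 0 ⟨le_rfl, hT.le⟩⟩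
    rwa [← Polynomial.coeff_zero_eq_eval_zero, ← Nat.sub_self (2 * n)] at this
  · have := hp.coeff_sign
    rwa [show n - 2 = 3 * n - 2 - 2 * n by omega] at this
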